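/- Let α ≥ 1, let 0 < ε < 1, and let ρ > 0 satisfy α·ln(1 − exp(−ρ²/2)) > −ε²/4. Suppose P ⊂ ℝⁿ is a polytope containing the set {x ∈ ℝⁿ : |⟨x, uᵢ⟩| ≤ 1 for i = 1, …, m}, where ‖uᵢ‖ ≤ 1 for all i and m ≤ αn. Then for all sufficiently large n, the standard Gaussian measure of the set {y ∈ ℝⁿ : max_{x ∈ P} ⟨x, y⟩ ≥ ρ⁻¹(1 − ε)n} is at least (1/2)·(1 − exp(−ρ²/2))^(αn). -/

import Mathlib

open MeasureTheory
open scoped RealInnerProductSpace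

/-- The standard Gaussian probability measure on `ℝⁿ`, with density
`(2π)^{-n/2} e^{-‖x‖²/2}` with respect to Lebesgue measure. -/
noncomputable def stdGaussian (n : ℕ) : Measure (EuclideanSpace ℝ (Fin n)) :=
  volume.withDensity fun x =>
    ENNReal.ofReal ((2 * Real.pi) ^ (-(n : ℝ) / 2) * Real.exp (-‖x‖ ^ 2 / 2))

open Set ENNReal

lemma volume_add_le_of_forall_add_mem {A B C : Set ℝ} (hA : MeasurableSet A)
    (hB : MeasurableSet B) (hA0 : A.Nonempty) (hB0 : B.Nonempty)
    (h : ∀ x ∈ A, ∀ y ∈ B, x + y ∈ C) : volume A + volume B ≤ volume C := by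
  have key : ∀ K ⊆ A, IsCompact K → K.Nonempty → ∀ L ⊆ B, IsCompact L → L.Nonempty →
      volume K + volume L ≤ volume C := by
    intro K hKA hK hK0 L hLB hL hL0
    obtain ⟨a, haK, ha⟩ := hK.exists_isGreatest hK0
    obtain ⟨b, hbL, hb⟩ := hL.exists_isLeast hL0
    have hdisj : AEDisjoint volume ((fun x => x + b) '' K) ((fun y => a + y) '' L) := by
      refine measure_mono_null (t := {a + b}) ?_ (by simp)
      rintro _ ⟨⟨x, hx, rfl⟩, ⟨y, hy, hxy⟩⟩
      have h1 := ha hx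
      have h2 := hb hy
      simp only [mem_singleton_iff] at *
      linarith
    have hmeas : MeasurableSet ((fun y => a + y) '' L) :=
      (hL.image (by fun_prop)).measurableSet
    calc volume K + volume L
        = volume ((fun x => x + b) '' K) + volume ((fun y => a + y) '' L) := by simp
      _ = volume ((fun x => x + b) '' K ∪ (fun y => a + y) '' L) :=
          (measure_union₀ hmeas.nullMeasurableSet hdisj).symm
      _ ≤ volume C := by
          refine measure_mono ?_
          rintro _ (⟨x, hx, rfl⟩ | ⟨y, hy, rfl⟩)
          · exact h x (hKA hx) b (hLB hbL)
          · exact h a (hKA haK) y (hLB hy)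
  obtain ⟨a, ha⟩ := hA0
  obtain ⟨b, hb⟩ := hB0
  have hsup : ∀ s : Set ℝ, MeasurableSet s →
      volume s = ⨆ K : Set ℝ, ⨆ _ : K ⊆ s ∧ IsCompact K, volume K := by
    intro s hs
    simp_rw [hs.measure_eq_iSup_isCompact, iSup_and]
  rw [hsup A hA, hsup B hB]
  refine ENNReal.biSup_add_biSup_le' (p := fun K => K ⊆ A ∧ IsCompact K)
    (q := fun K => K ⊆ B ∧ IsCompact K) ⟨∅, by simp⟩ ⟨∅, by simp⟩ ?_
  rintro K ⟨hKA, hK⟩ L ⟨hLB, hL⟩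
  refine le_trans (add_le_add (measure_mono (subset_insert a K)) (measure_mono (subset_insert b L))) ?_
  exact key _ (insert_subset ha hKA) (hK.insert a) (insert_nonempty _ _)
    _ (insert_subset hb hLB) (hL.insert b) (insert_nonempty _ _)

lemma lintegral_eq_lintegral_Ioo_measure_lt {X : Type*} [MeasurableSpace X] (μ : Measure X)
    {f : X → ℝ≥0∞} (hf : Measurable f) (hf1 : ∀ x, f x ≤ 1) :
    ∫⁻ x, f x ∂μ = ∫⁻ t in Ioo (0 : ℝ) 1, μ {x | ENNReal.ofReal t < f x} := by
  have hne : ∀ x, f x ≠ ∞ := fun x => ((hf1 x).trans_lt one_lt_top).ne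
  have h := lintegral_eq_lintegral_meas_lt μ (f := fun x => (f x).toReal)
    (.of_forall fun _ => toReal_nonneg) hf.ennreal_toReal.aemeasurable
  simp only [ofReal_toReal (hne _)] at h
  rw [h, ← lintegral_indicator measurableSet_Ioi, ← lintegral_indicator measurableSet_Ioo]
  congr 1 with t
  rcases le_or_gt t 0 with h0 | h0
  · simp [h0]
  rcases lt_or_ge t 1 with h1 | h1
  · simp [h0, h1, ofReal_lt_iff_lt_toReal h0.le (hne _)]
  · have : ∀ x, ¬ t < (f x).toReal := fun x => not_lt.2 <|
      (toReal_mono one_ne_top (hf1 x)).trans (by simpa using h1)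
    simp [h0, h1, this]

lemma prekopa_leindler_real_of_iSup_eq_one {l : ℝ} (hl0 : 0 < l) (hl1 : l < 1)
    {f g h : ℝ → ℝ≥0∞} (hf : Measurable f) (hg : Measurable g) (hh : Measurable h)
    (hf1 : (⨆ x, f x) = 1) (hg1 : (⨆ x, g x) = 1)
    (hfgh : ∀ x y, f x ^ l * g y ^ (1 - l) ≤ h (l * x + (1 - l) * y)) :
    ENNReal.ofReal l * (∫⁻ x, f x) + ENNReal.ofReal (1 - l) * (∫⁻ x, g x) ≤ ∫⁻ x, h x := by
  have hl1' : 0 < 1 - l := by linarith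
  have hfle : ∀ x, f x ≤ 1 := fun x => hf1 ▸ le_iSup f x
  have hgle : ∀ x, g x ≤ 1 := fun x => hg1 ▸ le_iSup g x
  have hm : Measurable fun x => min (h x) 1 := hh.min measurable_const
  refine le_trans ?_ (lintegral_mono (fun x => min_le_left (h x) 1))
  rw [lintegral_eq_lintegral_Ioo_measure_lt _ hf hfle, lintegral_eq_lintegral_Ioo_measure_lt _ hg hgle,
    lintegral_eq_lintegral_Ioo_measure_lt _ hm fun _ => min_le_right _ _,
    ← lintegral_const_mul' _ _ ofReal_ne_top, ← lintegral_const_mul' _ _ ofReal_ne_top]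
  refine (le_lintegral_add _ _).trans (setLIntegral_mono' measurableSet_Ioo fun t ht => ?_)
  have ht1 : ENNReal.ofReal t < 1 := by simpa using ht.2
  obtain ⟨x₀, hx₀⟩ := lt_iSup_iff.1 (hf1.symm ▸ ht1)
  obtain ⟨y₀, hy₀⟩ := lt_iSup_iff.1 (hg1.symm ▸ ht1)
  have hA : MeasurableSet {x | ENNReal.ofReal t < f x} := measurableSet_lt measurable_const hf
  have hB : MeasurableSet {x | ENNReal.ofReal t < g x} := measurableSet_lt measurable_const hg
  have e1 := Measure.addHaar_smul (volume : Measure ℝ) l {x | ENNReal.ofReal t < f x}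
  have e2 := Measure.addHaar_smul (volume : Measure ℝ) (1 - l) {x | ENNReal.ofReal t < g x}
  simp only [Module.finrank_self, pow_one, abs_of_pos hl0, abs_of_pos hl1'] at e1 e2
  rw [← e1, ← e2]
  refine volume_add_le_of_forall_add_mem (hA.const_smul₀ l) (hB.const_smul₀ (1 - l))
    ⟨_, smul_mem_smul_set hx₀⟩ ⟨_, smul_mem_smul_set hy₀⟩ ?_
  rintro _ ⟨x, hx, rfl⟩ _ ⟨y, hy, rfl⟩
  simp only [mem_ofPred_eq, smul_eq_mul, lt_min_iff] at *
  refine ⟨lt_of_lt_of_le ?_ (hfgh x y), ht1⟩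
  have h0 : ENNReal.ofReal t ≠ 0 := by simpa using ht.1
  calc ENNReal.ofReal t = ENNReal.ofReal t ^ l * ENNReal.ofReal t ^ (1 - l) := by
        rw [← ENNReal.rpow_add _ _ h0 ofReal_ne_top]; simp
    _ < f x ^ l * g y ^ (1 - l) :=
        ENNReal.mul_lt_mul (ENNReal.rpow_lt_rpow hx hl0) (ENNReal.rpow_lt_rpow hy hl1')

lemma ennreal_geom_mean_le_arith_mean {l : ℝ} (hl0 : 0 < l) (hl1 : l < 1) (a b : ℝ≥0∞) :
    a ^ l * b ^ (1 - l) ≤ ENNReal.ofReal l * a + ENNReal.ofReal (1 - l) * b := by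
  have hl1' : 0 < 1 - l := by linarith
  rcases eq_or_ne a ∞ with rfl | ha
  · simp [mul_top, hl0]
  rcases eq_or_ne b ∞ with rfl | hb
  · simp [mul_top, hl1]
  lift a to NNReal using ha
  lift b to NNReal using hb
  have := Real.geom_mean_le_arith_mean2_weighted hl0.le hl1'.le a.2 b.2 (by ring)
  have := ENNReal.ofReal_le_ofReal this
  simpa [ENNReal.ofReal_mul, ENNReal.ofReal_add, hl0.le, hl1'.le, mul_nonneg, Real.rpow_nonneg,
    ← ENNReal.ofReal_rpow_of_nonneg] using this

lemma prekopa_leindler_real {l : ℝ} (hl0 : 0 < l) (hl1 : l < 1)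
    {f g h : ℝ → ℝ≥0∞} (hf : Measurable f) (hg : Measurable g) (hh : Measurable h)
    (hf1 : (⨆ x, f x) ≠ ∞) (hg1 : (⨆ x, g x) ≠ ∞)
    (hfgh : ∀ x y, f x ^ l * g y ^ (1 - l) ≤ h (l * x + (1 - l) * y)) :
    (∫⁻ x, f x) ^ l * (∫⁻ x, g x) ^ (1 - l) ≤ ∫⁻ x, h x := by
  have hl1' : 0 < 1 - l := by linarith
  set a := ⨆ x, f x with ha
  set b := ⨆ x, g x with hb
  rcases eq_or_ne a 0 with ha0 | ha0
  · have : f = 0 := by ext x; simpa using (iSup_eq_zero.1 ha0) x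
    simp [this, hl0]
  rcases eq_or_ne b 0 with hb0 | hb0
  · have : g = 0 := by ext x; simpa using (iSup_eq_zero.1 hb0) x
    simp [this, hl1]
  set c := a ^ l * b ^ (1 - l) with hc
  have hc0 : c ≠ 0 := by simp [hc, ENNReal.rpow_eq_zero_iff, ha0, hb0, hf1, hg1]
  have hct : c ≠ ∞ := by
    exact ENNReal.mul_ne_top (ENNReal.rpow_ne_top_of_nonneg hl0.le hf1)
      (ENNReal.rpow_ne_top_of_nonneg hl1'.le hg1)
  have hcinv : c⁻¹ = a⁻¹ ^ l * b⁻¹ ^ (1 - l) := by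
    rw [hc, ENNReal.mul_inv, ENNReal.inv_rpow, ENNReal.inv_rpow]
    · simp [ENNReal.rpow_eq_zero_iff, ha0, hf1]
    · exact Or.inl (ENNReal.rpow_ne_top_of_nonneg hl0.le hf1)
  have key := prekopa_leindler_real_of_iSup_eq_one hl0 hl1 (f := fun x => a⁻¹ * f x)
    (g := fun x => b⁻¹ * g x) (h := fun x => c⁻¹ * h x) (hf.const_mul _) (hg.const_mul _)
    (hh.const_mul _) (by rw [← ENNReal.mul_iSup, ENNReal.inv_mul_cancel ha0 hf1])
    (by rw [← ENNReal.mul_iSup, ENNReal.inv_mul_cancel hb0 hg1])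
    (fun x y => by
      rw [ENNReal.mul_rpow_of_nonneg _ _ hl0.le, ENNReal.mul_rpow_of_nonneg _ _ hl1'.le,
        mul_mul_mul_comm, ← hcinv]
      gcongr
      exact hfgh x y)
  have key2 := (ennreal_geom_mean_le_arith_mean hl0 hl1 _ _).trans key
  rw [lintegral_const_mul _ hf, lintegral_const_mul _ hg, lintegral_const_mul _ hh,
    ENNReal.mul_rpow_of_nonneg _ _ hl0.le, ENNReal.mul_rpow_of_nonneg _ _ hl1'.le,
        mul_mul_mul_comm, ← hcinv] at key2
  exact (ENNReal.mul_le_mul_iff_right (by simpa using hct) (by simpa using hc0)).1 key2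

/-- The Prékopa–Leindler inequality with weights `l`, `1 - l` for functions bounded by `1`. -/
def PrekopaLeindler {E : Type*} [AddCommGroup E] [Module ℝ E] [MeasurableSpace E] (l : ℝ)
    (μ : Measure E) : Prop :=
  ∀ f g h : E → ℝ≥0∞, Measurable f → Measurable g → Measurable h → (∀ x, f x ≤ 1) →
    (∀ x, g x ≤ 1) → (∀ x y, f x ^ l * g y ^ (1 - l) ≤ h (l • x + (1 - l) • y)) →
    (∫⁻ x, f x ∂μ) ^ l * (∫⁻ x, g x ∂μ) ^ (1 - l) ≤ ∫⁻ x, h x ∂μ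

namespace PrekopaLeindler

lemma gaussianPDF_le_one (x : ℝ) : ProbabilityTheory.gaussianPDF 0 1 x ≤ 1 := by
  rw [ProbabilityTheory.gaussianPDF, ofReal_le_one, ProbabilityTheory.gaussianPDFReal]
  refine mul_le_one₀ ?_ (Real.exp_nonneg _) ?_
  · refine inv_le_one_of_one_le₀ (Real.one_le_sqrt.2 ?_)
    have := Real.pi_gt_three
    simp only [NNReal.coe_one]
    linarith
  · rw [Real.exp_le_one_iff]
    simp only [NNReal.coe_one]
    nlinarith [sq_nonneg (x - 0)]

lemma gaussianPDF_rpow_mul_le {l : ℝ} (hl0 : 0 < l) (hl1 : l < 1) (x y : ℝ) :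
    ProbabilityTheory.gaussianPDF 0 1 x ^ l * ProbabilityTheory.gaussianPDF 0 1 y ^ (1 - l) ≤
      ProbabilityTheory.gaussianPDF 0 1 (l * x + (1 - l) * y) := by
  have hl1' : 0 < 1 - l := by linarith
  have h0 := fun z : ℝ => ProbabilityTheory.gaussianPDFReal_nonneg 0 1 z
  simp only [ProbabilityTheory.gaussianPDF]
  rw [ofReal_rpow_of_nonneg (h0 _) hl0.le, ofReal_rpow_of_nonneg (h0 _) hl1'.le,
    ← ofReal_mul (Real.rpow_nonneg (h0 _) _)]
  refine ofReal_le_ofReal ?_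
  simp only [ProbabilityTheory.gaussianPDFReal]
  set c := (√(2 * Real.pi * ((1 : NNReal) : ℝ)))⁻¹ with hc
  have hc0 : 0 < c := by rw [hc]; simp; positivity
  rw [Real.mul_rpow hc0.le (Real.exp_nonneg _), Real.mul_rpow hc0.le (Real.exp_nonneg _),
    mul_mul_mul_comm, ← Real.rpow_add hc0, ← Real.exp_mul, ← Real.exp_mul, ← Real.exp_add]
  simp only [add_sub_cancel, Real.rpow_one, NNReal.coe_one]
  gcongr
  nlinarith [mul_nonneg (mul_nonneg hl0.le hl1'.le) (sq_nonneg (x - y))]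

lemma of_gaussianReal {l : ℝ} (hl0 : 0 < l) (hl1 : l < 1) :
    PrekopaLeindler l (ProbabilityTheory.gaussianReal 0 1) := by
  intro f g h hf hg hh hf1 hg1 hfgh
  have hl1' : 0 < 1 - l := by linarith
  have hφ := ProbabilityTheory.measurable_gaussianPDF 0 1
  rw [ProbabilityTheory.gaussianReal_of_var_ne_zero _ one_ne_zero,
    lintegral_withDensity_eq_lintegral_mul _ hφ hf, lintegral_withDensity_eq_lintegral_mul _ hφ hg,
    lintegral_withDensity_eq_lintegral_mul _ hφ hh]
  have hb : ∀ k : ℝ → ℝ≥0∞, (∀ x, k x ≤ 1) →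
      (⨆ x, (ProbabilityTheory.gaussianPDF 0 1 * k) x) ≠ ∞ := fun k hk =>
    ((iSup_le fun x => mul_le_one' (gaussianPDF_le_one x) (hk x)).trans_lt one_lt_top).ne
  refine prekopa_leindler_real hl0 hl1 (hφ.mul hf) (hφ.mul hg) (hφ.mul hh) (hb f hf1) (hb g hg1) ?_
  intro x y
  simp only [Pi.mul_apply]
  rw [ENNReal.mul_rpow_of_nonneg _ _ hl0.le, ENNReal.mul_rpow_of_nonneg _ _ hl1'.le,
    mul_mul_mul_comm]
  exact mul_le_mul' (gaussianPDF_rpow_mul_le hl0 hl1 x y) (hfgh x y)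

variable {E F : Type*} [AddCommGroup E] [Module ℝ E] [MeasurableSpace E]
  [AddCommGroup F] [Module ℝ F] [MeasurableSpace F] {l : ℝ}

lemma prod {μ : Measure E} {ν : Measure F} [SFinite μ] [IsProbabilityMeasure ν]
    (hμ : PrekopaLeindler l μ) (hν : PrekopaLeindler l ν) : PrekopaLeindler l (μ.prod ν) := by
  intro f g h hf hg hh hf1 hg1 hfgh
  rw [lintegral_prod _ hf.aemeasurable, lintegral_prod _ hg.aemeasurable,
    lintegral_prod _ hh.aemeasurable]
  have hle : ∀ k : E × F → ℝ≥0∞, (∀ z, k z ≤ 1) → ∀ x, ∫⁻ y, k (x, y) ∂ν ≤ 1 := by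
    intro k hk x
    simpa using lintegral_mono (μ := ν) fun y => hk (x, y)
  refine hμ _ _ _ hf.lintegral_prod_right' hg.lintegral_prod_right' hh.lintegral_prod_right'
    (hle f hf1) (hle g hg1) fun x₁ x₂ => ?_
  exact hν _ _ _ (hf.comp measurable_prodMk_left) (hg.comp measurable_prodMk_left)
    (hh.comp measurable_prodMk_left) (fun y => hf1 _) (fun y => hg1 _)
    fun y₁ y₂ => hfgh (x₁, y₁) (x₂, y₂)

lemma map {μ : Measure E} (hμ : PrekopaLeindler l μ) (T : E →ₗ[ℝ] F) (hT : Measurable T) :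
    PrekopaLeindler l (μ.map T) := by
  intro f g h hf hg hh hf1 hg1 hfgh
  rw [lintegral_map hf hT, lintegral_map hg hT, lintegral_map hh hT]
  refine hμ _ _ _ (hf.comp hT) (hg.comp hT) (hh.comp hT) (fun _ => hf1 _) (fun _ => hg1 _) ?_
  intro x y
  simpa using hfgh (T x) (T y)

lemma pi_gaussianReal (hl0 : 0 < l) (hl1 : l < 1) (n : ℕ) :
    PrekopaLeindler l (Measure.pi fun _ : Fin n => ProbabilityTheory.gaussianReal 0 1) := by
  induction n with
  | zero =>
    intro f g h hf hg hh _ _ hfgh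
    rw [Measure.pi_of_empty, lintegral_dirac' _ hf, lintegral_dirac' _ hg, lintegral_dirac' _ hh]
    exact (hfgh _ _).trans_eq (congrArg h (Subsingleton.elim _ _))
  | succ n ih =>
    have h := (measurePreserving_piFinSuccAbove
      (fun _ : Fin (n + 1) => ProbabilityTheory.gaussianReal 0 1) 0).symm
    rw [← h.map_eq]
    let T : (ℝ × (Fin n → ℝ)) →ₗ[ℝ] (Fin (n + 1) → ℝ) :=
      { toFun := fun p => Fin.cons p.1 p.2
        map_add' := fun p q => by ext i; refine Fin.cases ?_ (fun j => ?_) i <;> simp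
        map_smul' := fun c p => by ext i; refine Fin.cases ?_ (fun j => ?_) i <;> simp }
    have hT : ⇑(MeasurableEquiv.piFinSuccAbove (fun _ : Fin (n + 1) => ℝ) 0).symm = T := by
      ext p i
      simp [T, MeasurableEquiv.piFinSuccAbove_symm_apply]
    rw [hT]
    exact ((of_gaussianReal hl0 hl1).prod ih).map T (hT ▸ MeasurableEquiv.measurable _)

lemma of_stdGaussian {V : Type*} [NormedAddCommGroup V] [InnerProductSpace ℝ V]
    [FiniteDimensional ℝ V] [MeasurableSpace V] [BorelSpace V] (hl0 : 0 < l) (hl1 : l < 1) :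
    PrekopaLeindler l (ProbabilityTheory.stdGaussian V) := by
  have := (pi_gaussianReal hl0 hl1 (Module.finrank ℝ V)).map
    (Fintype.linearCombination ℝ (stdOrthonormalBasis ℝ V)) (by
      change Measurable fun x : Fin (Module.finrank ℝ V) → ℝ =>
        ∑ i, x i • stdOrthonormalBasis ℝ V i
      fun_prop)
  exact this

lemma measure_rpow_mul_le {μ : Measure E} (hμ : PrekopaLeindler l μ) (hl0 : 0 < l) (hl1 : l < 1)
    {A B C : Set E}
    (hA : MeasurableSet A) (hB : MeasurableSet B) (hC : MeasurableSet C)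
    (h : ∀ x ∈ A, ∀ y ∈ B, l • x + (1 - l) • y ∈ C) : μ A ^ l * μ B ^ (1 - l) ≤ μ C := by
  have hl1' : 0 < 1 - l := by linarith
  have := hμ (A.indicator 1) (B.indicator 1) (C.indicator 1) (measurable_one.indicator hA)
    (measurable_one.indicator hB) (measurable_one.indicator hC)
    (fun x => indicator_le_self' (by simp) x) (fun x => indicator_le_self' (by simp) x) ?_
  · simpa [lintegral_indicator_one, hA, hB, hC] using this
  intro x y
  by_cases hx : x ∈ A
  · by_cases hy : y ∈ B
    · simp [hx, hy, h x hx y hy]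
    · simp [hy, hl1]
  · simp [hx, hl0]

end PrekopaLeindler

section SlabCorrelation

variable {V : Type*} [NormedAddCommGroup V] [InnerProductSpace ℝ V] [FiniteDimensional ℝ V]
  [MeasurableSpace V] [BorelSpace V]

lemma stdGaussian_prod_map_orthogonal_decomposition {u : V} (hu : ‖u‖ = 1) :
    ((ProbabilityTheory.stdGaussian V).prod (ProbabilityTheory.stdGaussian V)).map
      (fun p => ⟪p.1, u⟫ • u + (p.2 - ⟪p.2, u⟫ • u)) = ProbabilityTheory.stdGaussian V := by
  have hmeas : Measurable fun p : V × V => ⟪p.1, u⟫ • u + (p.2 - ⟪p.2, u⟫ • u) := by fun_prop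
  have : IsProbabilityMeasure
      (((ProbabilityTheory.stdGaussian V).prod (ProbabilityTheory.stdGaussian V)).map
        (fun p => ⟪p.1, u⟫ • u + (p.2 - ⟪p.2, u⟫ • u))) :=
    Measure.isProbabilityMeasure_map hmeas.aemeasurable
  refine Measure.ext_of_charFun ?_
  ext ξ
  rw [charFun_apply, integral_map hmeas.aemeasurable (by fun_prop)]
  have hsplit : ∀ p : V × V,
      Complex.exp (⟪⟪p.1, u⟫ • u + (p.2 - ⟪p.2, u⟫ • u), ξ⟫ * Complex.I) =
        Complex.exp (⟪p.1, ⟪u, ξ⟫ • u⟫ * Complex.I) *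
          Complex.exp (⟪p.2, ξ - ⟪u, ξ⟫ • u⟫ * Complex.I) := by
    intro p
    rw [← Complex.exp_add, ← add_mul, ← Complex.ofReal_add]
    congr 3
    simp only [inner_add_left, inner_sub_left, inner_smul_left, inner_smul_right,
      inner_sub_right, conj_trivial]
    ring
  simp_rw [hsplit]
  rw [integral_prod_mul (fun x : V => Complex.exp (⟪x, ⟪u, ξ⟫ • u⟫ * Complex.I))
    (fun x : V => Complex.exp (⟪x, ξ - ⟪u, ξ⟫ • u⟫ * Complex.I)), ← charFun_apply,
    ← charFun_apply, ProbabilityTheory.charFun_stdGaussian, ProbabilityTheory.charFun_stdGaussian,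
    ProbabilityTheory.charFun_stdGaussian, ← Complex.exp_add]
  congr 1
  have h : ‖⟪u, ξ⟫ • u‖ ^ 2 + ‖ξ - ⟪u, ξ⟫ • u‖ ^ 2 = ‖ξ‖ ^ 2 := by
    rw [norm_sub_sq_real, norm_smul, hu, inner_smul_right, real_inner_comm, Real.norm_eq_abs,
      mul_one, sq_abs]
    ring
  have h' := congrArg (fun r : ℝ => (r : ℂ)) h
  push_cast at h'
  linear_combination -h' / 2

variable {K : Set V}

lemma stdGaussian_section_neg (hKs : ∀ x ∈ K, -x ∈ K) (hKm : MeasurableSet K) (u : V) (t : ℝ) :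
    ProbabilityTheory.stdGaussian V {x | (-t) • u + (x - ⟪x, u⟫ • u) ∈ K} =
      ProbabilityTheory.stdGaussian V {x | t • u + (x - ⟪x, u⟫ • u) ∈ K} := by
  conv_lhs => rw [← ProbabilityTheory.stdGaussian_map (LinearIsometryEquiv.neg ℝ (E := V))]
  have hm : MeasurableSet {x : V | (-t) • u + (x - ⟪x, u⟫ • u) ∈ K} :=
    hKm.preimage (by fun_prop)
  rw [Measure.map_apply (by fun_prop) hm]
  congr 1
  ext x
  have e : (-t) • u + (-x - ⟪-x, u⟫ • u) = -(t • u + (x - ⟪x, u⟫ • u)) := by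
    rw [inner_neg_left]; module
  simp only [mem_preimage, mem_ofPred_eq, LinearIsometryEquiv.coe_neg, e]
  exact ⟨fun h => by simpa using hKs _ h, fun h => hKs _ h⟩

lemma stdGaussian_section_anti (hKc : Convex ℝ K) (hKs : ∀ x ∈ K, -x ∈ K)
    (hKm : MeasurableSet K) (u : V) {s t : ℝ} (hst : |s| ≤ |t|) :
    ProbabilityTheory.stdGaussian V {x | t • u + (x - ⟪x, u⟫ • u) ∈ K} ≤
      ProbabilityTheory.stdGaussian V {x | s • u + (x - ⟪x, u⟫ • u) ∈ K} := by
  have hneg := stdGaussian_section_neg hKs hKm u t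
  have hm : ∀ r : ℝ, MeasurableSet {x : V | r • u + (x - ⟪x, u⟫ • u) ∈ K} :=
    fun r => hKm.preimage (by fun_prop)
  rcases hst.eq_or_lt with h | h
  · rcases abs_eq_abs.1 h with rfl | rfl
    · exact le_rfl
    · exact hneg.ge
  set a := ProbabilityTheory.stdGaussian V {x | t • u + (x - ⟪x, u⟫ • u) ∈ K} with ha
  rcases eq_or_ne a 0 with h0 | h0
  · simp [h0]
  have ht : t ≠ 0 := by
    rintro rfl
    simp only [abs_zero] at h
    exact absurd h (abs_nonneg s).not_gt
  have hlt : |s / t| < 1 := by rwa [abs_div, div_lt_one (abs_pos.2 ht)]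
  obtain ⟨h1, h2⟩ := abs_lt.1 hlt
  have hl0 : 0 < (1 + s / t) / 2 := by linarith
  have hl1 : (1 + s / t) / 2 < 1 := by linarith
  have key := (PrekopaLeindler.of_stdGaussian (V := V) hl0 hl1).measure_rpow_mul_le hl0 hl1
    (hm t) (hm (-t)) (hm s) (fun x hx y hy => by
      have := hKc hx hy hl0.le (sub_nonneg.2 hl1.le) (by ring)
      have e : s = ((1 + s / t) / 2) * t + (1 - (1 + s / t) / 2) * (-t) := by
        field_simp
        ring
      simp only [mem_ofPred_eq]
      convert this using 1
      nth_rewrite 1 [e]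
      rw [inner_add_left, inner_smul_left, inner_smul_left]
      simp only [conj_trivial]
      module)
  rw [hneg, ← ENNReal.rpow_add _ _ h0 (measure_ne_top _ _)] at key
  simpa using key

lemma stdGaussian_mul_slab_le_inter_of_norm_eq_one (hKc : Convex ℝ K) (hKs : ∀ x ∈ K, -x ∈ K)
    (hKm : MeasurableSet K) {u : V} (hu : ‖u‖ = 1) {c : ℝ} (hc : 0 ≤ c) :
    ProbabilityTheory.stdGaussian V K * ProbabilityTheory.stdGaussian V {x | |⟪x, u⟫| ≤ c} ≤
      ProbabilityTheory.stdGaussian V (K ∩ {x | |⟪x, u⟫| ≤ c}) := by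
  set γ := ProbabilityTheory.stdGaussian V with hγ
  set S : Set V := {x | |⟪x, u⟫| ≤ c} with hS
  have hSm : MeasurableSet S := measurableSet_le (by fun_prop) measurable_const
  set g : ℝ → ℝ≥0∞ := fun t => γ {x | t • u + (x - ⟪x, u⟫ • u) ∈ K} with hg
  have hint : ∀ W : Set V, MeasurableSet W → (∀ x y : V, ⟪x, u⟫ = ⟪y, u⟫ → x ∈ W → y ∈ W) →
      γ (K ∩ W) = ∫⁻ y in W, g ⟪y, u⟫ ∂γ := by
    intro W hW hWu
    have hΦ : Measurable fun p : V × V => ⟪p.1, u⟫ • u + (p.2 - ⟪p.2, u⟫ • u) := by fun_prop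
    conv_lhs => rw [hγ, ← stdGaussian_prod_map_orthogonal_decomposition hu, ← hγ]
    rw [Measure.map_apply hΦ (hKm.inter hW), Measure.prod_apply (hΦ (hKm.inter hW)),
      ← lintegral_indicator hW]
    congr 1 with y
    have hin : ∀ x : V, ⟪⟪y, u⟫ • u + (x - ⟪x, u⟫ • u), u⟫ = ⟪y, u⟫ := by
      intro x
      simp [inner_add_left, inner_sub_left, inner_smul_left, hu]
    by_cases hy : y ∈ W
    · rw [indicator_of_mem hy]
      simp only [hg]
      congr 1 with x
      have := hWu _ _ (hin x).symm hy
      simp [this]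
    · rw [indicator_of_notMem hy]
      convert measure_empty (μ := γ)
      ext x
      have : ⟪y, u⟫ • u + (x - ⟪x, u⟫ • u) ∉ W := fun h => hy (hWu _ _ (hin x) h)
      simp [this]
  have h1 := hint S hSm (fun x y hxy hx => by simpa [hS, ← hxy] using hx)
  have h2 := hint Sᶜ hSm.compl (fun x y hxy hx => by simpa [hS, ← hxy] using hx)
  have hanti : ∀ {s t : ℝ}, |s| ≤ |t| → g t ≤ g s :=
    fun h => stdGaussian_section_anti hKc hKs hKm u h
  have hin : g c * γ S ≤ γ (K ∩ S) := by
    rw [h1, ← setLIntegral_const]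
    exact setLIntegral_mono' hSm fun y hy => hanti (by rw [abs_of_nonneg hc]; exact hy)
  have hout : γ (K ∩ Sᶜ) ≤ g c * γ Sᶜ := by
    rw [h2, ← setLIntegral_const]
    refine setLIntegral_mono' hSm.compl fun y hy => hanti ?_
    rw [abs_of_nonneg hc]
    exact le_of_not_ge hy
  calc γ K * γ S = γ (K ∩ S) * γ S + γ (K ∩ Sᶜ) * γ S := by
        rw [← add_mul, ← sdiff_eq, measure_inter_add_sdiff K hSm]
    _ ≤ γ (K ∩ S) * γ S + g c * γ Sᶜ * γ S := by gcongr
    _ = γ (K ∩ S) * γ S + g c * γ S * γ Sᶜ := by ring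
    _ ≤ γ (K ∩ S) * γ S + γ (K ∩ S) * γ Sᶜ := by gcongr
    _ = γ (K ∩ S) := by rw [← mul_add, measure_add_measure_compl hSm, measure_univ, mul_one]

lemma stdGaussian_slab {u : V} (hu : ‖u‖ = 1) (c : ℝ) :
    ProbabilityTheory.stdGaussian V {x | |⟪x, u⟫| ≤ c} =
      ProbabilityTheory.gaussianReal 0 1 {t | |t| ≤ c} := by
  have h : (ProbabilityTheory.stdGaussian V).map (fun x => ⟪x, u⟫) =
      ProbabilityTheory.gaussianReal 0 1 := by
    have : IsProbabilityMeasure ((ProbabilityTheory.stdGaussian V).map (fun x => ⟪x, u⟫)) :=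
      Measure.isProbabilityMeasure_map (by fun_prop)
    refine Measure.ext_of_charFun ?_
    ext t
    rw [charFun_apply_real, integral_map (by fun_prop) (by fun_prop)]
    have := ProbabilityTheory.charFun_stdGaussian (t • u)
    rw [charFun_apply] at this
    simp only [inner_smul_right, norm_smul, hu, Complex.ofReal_mul] at this
    rw [this, ProbabilityTheory.charFun_gaussianReal]
    congr 1
    simp [← Complex.ofReal_pow, neg_div]
  rw [← h, Measure.map_apply (by fun_prop) (measurableSet_le (by fun_prop) measurable_const)]
  rfl

lemma gaussianReal_pow_le_stdGaussian_iInter_slab {ρ : ℝ} (hρ : 0 ≤ ρ) {ι : Type*} (s : Finset ι)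
    (u : ι → V) (hu : ∀ i, ‖u i‖ ≤ 1) :
    ProbabilityTheory.gaussianReal 0 1 {t | |t| ≤ ρ} ^ s.card ≤
      ProbabilityTheory.stdGaussian V {x | ∀ i ∈ s, |⟪x, u i⟫| ≤ ρ} := by
  classical
  induction s using Finset.induction_on with
  | empty => simp
  | insert i s his ih =>
    set K : Set V := {x | ∀ i ∈ s, |⟪x, u i⟫| ≤ ρ} with hK
    have hKeq : K = ⋂ i ∈ s, (fun x => ⟪x, u i⟫) ⁻¹' Icc (-ρ) ρ := by
      ext x; simp [hK, abs_le]
    have hKc : Convex ℝ K := by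
      rw [hKeq]
      refine convex_iInter₂ fun i _ => (convex_Icc (-ρ) ρ).is_linear_preimage ?_
      exact ⟨fun x y => inner_add_left _ _ _, fun c x => by simp [inner_smul_left]⟩
    have hKm : MeasurableSet K := by
      rw [hKeq]
      exact s.measurableSet_biInter fun i _ => measurableSet_Icc.preimage (by fun_prop)
    have hKs : ∀ x ∈ K, -x ∈ K := fun x hx i hi => by
      simpa [inner_neg_left] using hx i hi
    rw [Finset.card_insert_of_notMem his, pow_succ]
    rcases eq_or_ne (u i) 0 with h0 | h0
    · refine (mul_le_of_le_one_right' prob_le_one).trans (ih.trans (measure_mono fun x hx => ?_))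
      have hx' : ∀ j ∈ s, |⟪x, u j⟫| ≤ ρ := hx
      simpa [h0, hρ] using hx'
    have hn : 0 < ‖u i‖ := norm_pos_iff.2 h0
    have hv : ‖(‖u i‖⁻¹ • u i)‖ = 1 := by
      rw [norm_smul, norm_inv, norm_norm, inv_mul_cancel₀ hn.ne']
    refine (mul_le_mul_left ih _).trans ?_
    rw [← stdGaussian_slab hv]
    refine ((stdGaussian_mul_slab_le_inter_of_norm_eq_one hKc hKs hKm hv hρ).trans
        (measure_mono ?_))
    rintro x ⟨hxK, hx⟩
    simp only [mem_ofPred_eq, inner_smul_right, abs_mul, abs_inv, abs_norm] at hx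
    refine fun j hj => (Finset.mem_insert.1 hj).elim (fun h => ?_) (hxK j)
    rw [h]
    rw [inv_mul_le_iff₀ hn] at hx
    exact hx.trans (mul_le_of_le_one_left hρ (hu i))

end SlabCorrelation

section GaussianTail

lemma gaussianReal_Ioi_le {ρ : ℝ} (hρ : 0 ≤ ρ) :
    ProbabilityTheory.gaussianReal 0 1 (Ioi ρ) ≤
      ENNReal.ofReal (Real.exp (-(ρ ^ 2) / 2)) * ProbabilityTheory.gaussianReal 0 1 (Ioi 0) := by
  have h0 : ProbabilityTheory.gaussianReal 0 1 (Ioi 0) =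
      ProbabilityTheory.gaussianReal ρ 1 (Ioi ρ) := by
    have h := ProbabilityTheory.gaussianReal_map_add_const (μ := 0) (v := 1) ρ
    rw [zero_add] at h
    rw [← h, Measure.map_apply (by fun_prop) measurableSet_Ioi]
    simp
  rw [h0, ProbabilityTheory.gaussianReal_apply _ one_ne_zero,
    ProbabilityTheory.gaussianReal_apply _ one_ne_zero, ← lintegral_const_mul' _ _ ofReal_ne_top]
  refine setLIntegral_mono' measurableSet_Ioi fun x hx => ?_
  rw [ProbabilityTheory.gaussianPDF, ProbabilityTheory.gaussianPDF,
    ← ofReal_mul (Real.exp_nonneg _)]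
  refine ofReal_le_ofReal ?_
  rw [ProbabilityTheory.gaussianPDFReal, ProbabilityTheory.gaussianPDFReal, mul_left_comm,
    ← Real.exp_add]
  gcongr
  have hx' : ρ < x := hx
  simp only [NNReal.coe_one]
  nlinarith [mul_nonneg hρ (sub_nonneg.2 hx'.le)]

lemma ofReal_one_sub_exp_le_gaussianReal {ρ : ℝ} (hρ : 0 ≤ ρ) :
    ENNReal.ofReal (1 - Real.exp (-(ρ ^ 2) / 2)) ≤
      ProbabilityTheory.gaussianReal 0 1 {t | |t| ≤ ρ} := by
  set γ := ProbabilityTheory.gaussianReal 0 1 with hγ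
  have hneg : ∀ r : ℝ, γ (Iio (-r)) = γ (Ioi r) := by
    intro r
    have h := ProbabilityTheory.gaussianReal_map_neg (μ := 0) (v := 1)
    rw [neg_zero, ← hγ] at h
    conv_lhs => rw [← h, Measure.map_apply (by fun_prop) measurableSet_Iio]
    simp
  have hm : MeasurableSet {t : ℝ | |t| ≤ ρ} := measurableSet_le (by fun_prop) measurable_const
  have hhalf : γ (Ioi 0) + γ (Ioi 0) ≤ 1 := by
    nth_rewrite 1 [← hneg 0]
    rw [neg_zero, ← measure_union (Iio_disjoint_Ioi_same (a := (0 : ℝ))) measurableSet_Ioi]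
    exact prob_le_one
  have hcompl : γ {t | |t| ≤ ρ}ᶜ ≤ ENNReal.ofReal (Real.exp (-(ρ ^ 2) / 2)) := by
    have hsub : {t : ℝ | |t| ≤ ρ}ᶜ ⊆ Iio (-ρ) ∪ Ioi ρ := by
      intro t ht
      have ht' : ρ < |t| := not_le.1 ht
      rcases lt_abs.1 ht' with h | h
      · exact Or.inr h
      · exact Or.inl (by simp only [mem_Iio]; linarith)
    calc γ {t | |t| ≤ ρ}ᶜ ≤ γ (Iio (-ρ)) + γ (Ioi ρ) :=
          (measure_mono hsub).trans (measure_union_le _ _)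
      _ = γ (Ioi ρ) + γ (Ioi ρ) := by rw [hneg]
      _ ≤ ENNReal.ofReal (Real.exp (-(ρ ^ 2) / 2)) * (γ (Ioi 0) + γ (Ioi 0)) := by
          rw [mul_add]
          exact add_le_add (gaussianReal_Ioi_le hρ) (gaussianReal_Ioi_le hρ)
      _ ≤ ENNReal.ofReal (Real.exp (-(ρ ^ 2) / 2)) := mul_le_of_le_one_right' hhalf
  rw [ofReal_sub _ (Real.exp_nonneg _), ofReal_one, tsub_le_iff_right,
    ← measure_univ (μ := γ), ← measure_add_measure_compl hm]
  gcongr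

end GaussianTail

lemma stdGaussian_eq (n : ℕ) :
    stdGaussian n = ProbabilityTheory.stdGaussian (EuclideanSpace ℝ (Fin n)) := by
  have hint : Integrable fun x : EuclideanSpace ℝ (Fin n) =>
      (2 * Real.pi) ^ (-(n : ℝ) / 2) * Real.exp (-‖x‖ ^ 2 / 2) := by
    refine Integrable.const_mul ?_ _
    have h := (GaussianFourier.integrable_cexp_neg_mul_sq_norm_add (b := 1 / 2) (by norm_num)
      0 (0 : EuclideanSpace ℝ (Fin n))).norm
    convert h using 2 with x
    rw [Complex.norm_exp]
    congr 1
    simp [← Complex.ofReal_pow]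
    ring
  have : IsFiniteMeasure (stdGaussian n) :=
    isFiniteMeasure_withDensity_ofReal hint.2
  refine Measure.ext_of_charFun ?_
  ext t
  rw [ProbabilityTheory.charFun_stdGaussian, charFun_apply, stdGaussian,
    integral_withDensity_eq_integral_toReal_smul (by fun_prop) (.of_forall fun _ => ofReal_lt_top)]
  have hpt : ∀ x : EuclideanSpace ℝ (Fin n),
      (ENNReal.ofReal ((2 * Real.pi) ^ (-(n : ℝ) / 2) * Real.exp (-‖x‖ ^ 2 / 2))).toReal •
        Complex.exp (⟪x, t⟫ * Complex.I) =
      (((2 * Real.pi) ^ (-(n : ℝ) / 2) : ℝ) : ℂ) *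
        Complex.exp (-(1 / 2 : ℂ) * ‖x‖ ^ 2 + Complex.I * ⟪t, x⟫) := by
    intro x
    rw [toReal_ofReal (by positivity), Complex.real_smul, Complex.ofReal_mul, mul_assoc,
      Complex.ofReal_exp, ← Complex.exp_add, real_inner_comm]
    congr 2
    push_cast
    ring
  simp_rw [hpt]
  rw [integral_const_mul, GaussianFourier.integral_cexp_neg_mul_sq_norm_add (by norm_num),
    finrank_euclideanSpace_fin, ← mul_assoc]
  have h1 : ((Real.pi : ℂ) / (1 / 2)) ^ ((n : ℂ) / 2) =
      (((2 * Real.pi) ^ ((n : ℝ) / 2) : ℝ) : ℂ) := by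
    rw [Complex.ofReal_cpow (by positivity)]
    push_cast
    congr 1
    ring
  rw [h1, ← Complex.ofReal_mul, ← Real.rpow_add (by positivity)]
  have h2 : -(n : ℝ) / 2 + n / 2 = 0 := by ring
  rw [h2, Real.rpow_zero, Complex.ofReal_one, one_mul, Complex.I_sq]
  congr 1
  ring

lemma stdGaussian_norm_sq_lt_le (n : ℕ) {ε : ℝ} (hε : 0 < ε) :
    stdGaussian n {x | ‖x‖ ^ 2 < (1 - ε) * n} ≤
      ENNReal.ofReal (Real.exp (-(ε ^ 2 / 4) * n)) := by
  have hm : MeasurableSet {x : EuclideanSpace ℝ (Fin n) | ‖x‖ ^ 2 < (1 - ε) * n} :=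
    measurableSet_lt (by fun_prop) measurable_const
  have hb : 0 < (1 + ε) / 2 := by linarith
  have hint : Integrable fun x : EuclideanSpace ℝ (Fin n) =>
      Real.exp (-((1 + ε) / 2) * ‖x‖ ^ 2) := by
    have h := (GaussianFourier.integrable_cexp_neg_mul_sq_norm_add (b := ((1 + ε) / 2 : ℝ))
      (by simpa using hb) 0 (0 : EuclideanSpace ℝ (Fin n))).norm
    convert h using 2 with x
    rw [Complex.norm_exp]
    congr 1
    simp [← Complex.ofReal_pow, -Complex.ofReal_div, -Complex.ofReal_add]
  set c : ℝ := (2 * Real.pi) ^ (-(n : ℝ) / 2) * Real.exp (ε / 2 * ((1 - ε) * n)) with hc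
  have hc0 : 0 ≤ c := by positivity
  rw [stdGaussian, withDensity_apply _ hm]
  calc ∫⁻ x in {x : EuclideanSpace ℝ (Fin n) | ‖x‖ ^ 2 < (1 - ε) * n},
        ENNReal.ofReal ((2 * Real.pi) ^ (-(n : ℝ) / 2) * Real.exp (-‖x‖ ^ 2 / 2))
      ≤ ∫⁻ x in {x : EuclideanSpace ℝ (Fin n) | ‖x‖ ^ 2 < (1 - ε) * n},
        ENNReal.ofReal (c * Real.exp (-((1 + ε) / 2) * ‖x‖ ^ 2)) := by
        refine setLIntegral_mono' hm fun x hx => ofReal_le_ofReal ?_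
        have hx' : ‖x‖ ^ 2 < (1 - ε) * n := hx
        rw [hc, mul_assoc, ← Real.exp_add]
        gcongr
        nlinarith [mul_pos hε (sub_pos.2 hx')]
    _ ≤ ∫⁻ x : EuclideanSpace ℝ (Fin n),
        ENNReal.ofReal (c * Real.exp (-((1 + ε) / 2) * ‖x‖ ^ 2)) := setLIntegral_le_lintegral _ _
    _ = ENNReal.ofReal (c * (Real.pi / ((1 + ε) / 2)) ^ ((n : ℝ) / 2)) := by
        rw [← ofReal_integral_eq_lintegral_ofReal (hint.const_mul c)
          (.of_forall fun x => by positivity), integral_const_mul,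
          GaussianFourier.integral_rexp_neg_mul_sq_norm hb, finrank_euclideanSpace_fin]
    _ ≤ ENNReal.ofReal (Real.exp (-(ε ^ 2 / 4) * n)) := by
        refine ofReal_le_ofReal ?_
        have hpi : Real.pi / ((1 + ε) / 2) = (2 * Real.pi) * (1 + ε)⁻¹ := by field_simp
        rw [hpi, Real.mul_rpow (by positivity) (by positivity), hc, mul_mul_mul_comm,
          ← Real.rpow_add (by positivity),
          Real.inv_rpow (by positivity), Real.rpow_def_of_pos (by positivity : 0 < 1 + ε),
          ← Real.exp_neg, ← Real.exp_add]
        have h2 : -(n : ℝ) / 2 + n / 2 = 0 := by ring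
        rw [h2, Real.rpow_zero, one_mul]
        gcongr
        have hlog : ε - ε ^ 2 / 2 ≤ Real.log (1 + ε) := by
          refine le_trans ?_ (Real.le_log_one_add_of_nonneg hε.le)
          rw [le_div_iff₀ (by linarith)]
          nlinarith [pow_pos hε 3]
        nlinarith [mul_le_mul_of_nonneg_right hlog (Nat.cast_nonneg (α := ℝ) n)]

lemma exists_forall_exp_neg_mul_le_half_exp {a b : ℝ} (hab : a < b) :
    ∃ N : ℕ, ∀ n : ℕ, N ≤ n → Real.exp (a * n) ≤ 1 / 2 * Real.exp (b * n) := by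
  refine ⟨⌈Real.log 2 / (b - a)⌉₊, fun n hn => ?_⟩
  have h := (div_le_iff₀ (sub_pos.2 hab)).1 (Nat.ceil_le.1 hn)
  have h2 : (1 / 2 : ℝ) = Real.exp (-Real.log 2) := by
    rw [Real.exp_neg, Real.exp_log two_pos, one_div]
  rw [h2, ← Real.exp_add]
  gcongr
  linarith

/-- Estimate (2.2.4): if `α ≥ 1`, `0 < ε < 1` and `ρ > 0` satisfies
`α ln(1 - e^{-ρ²/2}) > -ε²/4`, and the polytope `P = conv S` contains
`{x : |⟨x, uᵢ⟩| ≤ 1, i = 1,…,m}` with `‖uᵢ‖ ≤ 1` and `m ≤ αn`, then for all sufficiently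
large `n` the Gaussian measure of `{y : max_{x ∈ P} ⟨x, y⟩ ≥ ρ⁻¹(1 - ε)n}` is at least
`(1/2)(1 - e^{-ρ²/2})^{αn}`. -/
theorem stmt_11 (α ε ρ : ℝ) (hα : 1 ≤ α) (hε0 : 0 < ε) (hε1 : ε < 1) (hρ : 0 < ρ)
    (h1 : -(ε ^ 2 / 4) < α * Real.log (1 - Real.exp (-(ρ ^ 2) / 2))) :
    ∃ N : ℕ, ∀ n : ℕ, N ≤ n →
      ∀ (m : ℕ) (u : Fin m → EuclideanSpace ℝ (Fin n))
        (S : Finset (EuclideanSpace ℝ (Fin n))),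
        (∀ i, ‖u i‖ ≤ 1) → (m : ℝ) ≤ α * n →
        {x : EuclideanSpace ℝ (Fin n) | ∀ i, |⟪x, u i⟫| ≤ 1} ⊆
          convexHull ℝ (S : Set (EuclideanSpace ℝ (Fin n))) →
        ENNReal.ofReal (1 / 2 * (1 - Real.exp (-(ρ ^ 2) / 2)) ^ (α * n)) ≤
          stdGaussian n
            {y : EuclideanSpace ℝ (Fin n) |
              ∃ x ∈ convexHull ℝ (S : Set (EuclideanSpace ℝ (Fin n))),
                ρ⁻¹ * (1 - ε) * n ≤ ⟪x, y⟫} := by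
  set q := 1 - Real.exp (-(ρ ^ 2) / 2) with hq
  have hq0 : 0 < q := by
    rw [hq, sub_pos, Real.exp_lt_one_iff]
    nlinarith [pow_pos hρ 2]
  have hq1 : q ≤ 1 := by
    rw [hq]
    linarith [Real.exp_pos (-(ρ ^ 2) / 2)]
  obtain ⟨N, hN⟩ := exists_forall_exp_neg_mul_le_half_exp h1
  refine ⟨N, fun n hn m u S hu hm hP => ?_⟩
  set A : Set (EuclideanSpace ℝ (Fin n)) := {x | ∀ i, |⟪x, u i⟫| ≤ ρ} with hA
  set B : Set (EuclideanSpace ℝ (Fin n)) := {x | ‖x‖ ^ 2 < (1 - ε) * n} with hB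
  have hpow : Real.exp (α * Real.log q * n) = q ^ (α * n) := by
    rw [Real.rpow_def_of_pos hq0]
    ring_nf
  have hBle : stdGaussian n B ≤ ENNReal.ofReal (1 / 2 * q ^ (α * n)) :=
    (stdGaussian_norm_sq_lt_le n hε0).trans (ofReal_le_ofReal (hpow ▸ hN n hn))
  have hAge : ENNReal.ofReal (q ^ (α * n)) ≤ stdGaussian n A := by
    have h := gaussianReal_pow_le_stdGaussian_iInter_slab hρ.le Finset.univ u hu
    simp only [Finset.card_univ, Fintype.card_fin, Finset.mem_univ, forall_true_left] at h
    rw [stdGaussian_eq]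
    refine le_trans ?_ h
    calc ENNReal.ofReal (q ^ (α * n)) ≤ ENNReal.ofReal (q ^ (m : ℝ)) :=
          ofReal_le_ofReal (Real.rpow_le_rpow_of_exponent_ge hq0 hq1 hm)
      _ = ENNReal.ofReal q ^ m := by rw [Real.rpow_natCast, ofReal_pow hq0.le]
      _ ≤ _ := by gcongr; exact ofReal_one_sub_exp_le_gaussianReal hρ.le
  have hsub : A \ B ⊆ {y | ∃ x ∈ convexHull ℝ (S : Set (EuclideanSpace ℝ (Fin n))),
      ρ⁻¹ * (1 - ε) * n ≤ ⟪x, y⟫} := by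
    rintro y ⟨hyA, hyB⟩
    refine ⟨ρ⁻¹ • y, hP fun i => ?_, ?_⟩
    · rw [inner_smul_left, conj_trivial, abs_mul, abs_of_pos (inv_pos.2 hρ), inv_mul_le_iff₀ hρ,
        mul_one]
      exact hyA i
    · have hy : (1 - ε) * n ≤ ‖y‖ ^ 2 := not_lt.1 hyB
      rw [inner_smul_left, conj_trivial, real_inner_self_eq_norm_sq, mul_assoc]
      gcongr
  calc ENNReal.ofReal (1 / 2 * q ^ (α * n))
      = ENNReal.ofReal (q ^ (α * n)) - ENNReal.ofReal (1 / 2 * q ^ (α * n)) := by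
        rw [← ofReal_sub _ (by positivity)]
        congr 1
        ring
    _ ≤ stdGaussian n A - stdGaussian n B := tsub_le_tsub hAge hBle
    _ ≤ stdGaussian n (A \ B) := le_measure_sdiff
    _ ≤ _ := measure_mono hsub
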